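/- arXiv:1003.2165 — 3 statements merged into one kernel-verified Lean document; each statement's English description precedes it below -/
import Mathlib

section
/- Let a > 0 be real and k ≥ 1 an integer. Then for every real ξ ≥ 0, ∫_0^ξ e^{−aρ}·m^k(ξ − ρ) dρ = Σ_{0 ≤ i ≤ ⌊ξ⌋} binom(k, i)·(−1)^i·cutexp_k(−(ξ − i)·a)/(−a)^k, where cutexp_k(ζ) = e^ζ − Σ_{0 ≤ ℓ ≤ k−1} ζ^ℓ/ℓ!. (With a = α·ln B this gives a closed form for λ̃_norm^k(ξ) = ∫_0^ξ B^{−ρα} m^k(ξ − ρ) dρ.) -/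
open MeasureTheory

/-- The polynomial hills `m^k`: `m^1` is the indicator of `[0,1)` and
`m^k(ξ) = ∫_{ξ-1}^{ξ} m^{k-1}(ρ) dρ` for `k ≥ 2`. (`hill 0` is junk.) -/
noncomputable def hill : ℕ → ℝ → ℝ
  | 0 => fun _ => 0
  | 1 => fun ξ => if 0 ≤ ξ ∧ ξ < 1 then 1 else 0
  | k + 2 => fun ξ => ∫ ρ in (ξ - 1)..ξ, hill (k + 1) ρ

/-- `cutexp k ζ = e^ζ - Σ_{ℓ < k} ζ^ℓ/ℓ!`. -/
noncomputable def cutexp (k : ℕ) (ζ : ℝ) : ℝ :=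
  Real.exp ζ - ∑ ℓ ∈ Finset.range k, ζ ^ ℓ / (Nat.factorial ℓ)

/-- The truncated power `x ↦ x₊ ^ k / k!`, equal to `1` at `x = 0` when `k = 0`. -/
noncomputable def truncPow (k : ℕ) (x : ℝ) : ℝ :=
  if 0 ≤ x then x ^ k / (Nat.factorial k) else 0

/-- The convolution of `truncPow k` with `ρ ↦ exp (-aρ)` on `[0, ∞)`, in closed form. -/
noncomputable def truncPowExp (a : ℝ) (k : ℕ) (x : ℝ) : ℝ :=
  if 0 ≤ x then cutexp (k + 1) (-(x * a)) / (-a) ^ (k + 1) else 0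

lemma truncPow_of_neg (k : ℕ) {x : ℝ} (hx : x < 0) : truncPow k x = 0 :=
  if_neg hx.not_ge

lemma truncPowExp_of_neg (a : ℝ) (k : ℕ) {x : ℝ} (hx : x < 0) : truncPowExp a k x = 0 :=
  if_neg hx.not_ge

lemma cutexp_succ (k : ℕ) (ζ : ℝ) :
    cutexp (k + 1) ζ = cutexp k ζ - ζ ^ k / (Nat.factorial k) := by
  simp only [cutexp, Finset.sum_range_succ]
  ring

lemma cutexp_succ_zero (k : ℕ) : cutexp (k + 1) 0 = 0 := by
  simp [cutexp, Finset.sum_range_succ']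

lemma hasDerivAt_pow_div_factorial (k : ℕ) (x : ℝ) :
    HasDerivAt (fun y : ℝ => y ^ (k + 1) / (Nat.factorial (k + 1)))
      (x ^ k / (Nat.factorial k)) x := by
  refine ((hasDerivAt_pow (k + 1) x).div_const _).congr_deriv ?_
  rw [Nat.factorial_succ]
  push_cast
  have : (Nat.factorial k : ℝ) ≠ 0 := by positivity
  have : (k : ℝ) + 1 ≠ 0 := by positivity
  field_simp

lemma hasDerivAt_cutexp_succ (k : ℕ) (ζ : ℝ) :
    HasDerivAt (cutexp (k + 1)) (cutexp k ζ) ζ := by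
  induction k with
  | zero =>
    have h : cutexp (0 + 1) = fun ζ => Real.exp ζ - 1 := by
      ext; simp [cutexp]
    rw [h]
    simpa [cutexp] using (Real.hasDerivAt_exp ζ).sub_const 1
  | succ k ih =>
    rw [funext (cutexp_succ (k + 1)), cutexp_succ k]
    exact ih.sub (hasDerivAt_pow_div_factorial k ζ)

lemma monotone_truncPow (k : ℕ) : Monotone (truncPow k) := by
  intro x y hxy
  unfold truncPow
  split_ifs with hx hy hy
  · gcongr
  · exact absurd (hx.trans hxy) hy
  · positivity
  · exact le_rfl

lemma continuous_truncPow_succ (k : ℕ) : Continuous (truncPow (k + 1)) := by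
  refine Continuous.if_le (by fun_prop) continuous_const continuous_const continuous_id ?_
  rintro x rfl
  simp

lemma hasDerivAt_truncPow_succ (k : ℕ) {x : ℝ} (hx : x ≠ 0) :
    HasDerivAt (truncPow (k + 1)) (truncPow k x) x := by
  rcases hx.lt_or_gt with hx | hx
  · rw [truncPow_of_neg k hx]
    refine (hasDerivAt_const x (0 : ℝ)).congr_of_eventuallyEq ?_
    filter_upwards [gt_mem_nhds hx] with y hy using truncPow_of_neg _ hy
  · rw [truncPow, if_pos hx.le]
    refine (hasDerivAt_pow_div_factorial k x).congr_of_eventuallyEq ?_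
    filter_upwards [lt_mem_nhds hx] with y hy using if_pos hy.le

lemma integral_truncPow (k : ℕ) (u v : ℝ) :
    ∫ x in u..v, truncPow k x = truncPow (k + 1) v - truncPow (k + 1) u :=
  integral_eq_of_hasDerivAt_off_countable _ _ (Set.countable_singleton 0)
    (continuous_truncPow_succ k).continuousOn
    (fun _ hx => hasDerivAt_truncPow_succ k hx.2)
    (monotone_truncPow k).intervalIntegrable

lemma continuous_truncPowExp (a : ℝ) (k : ℕ) : Continuous (truncPowExp a k) := by
  have hc : Continuous (cutexp (k + 1)) :=
    continuous_iff_continuousAt.2 fun ζ => (hasDerivAt_cutexp_succ k ζ).continuousAt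
  refine Continuous.if_le (by fun_prop) continuous_const continuous_const continuous_id ?_
  rintro x rfl
  simp [cutexp_succ_zero]

lemma hasDerivAt_truncPowExp {a : ℝ} (ha : a ≠ 0) (k : ℕ) {x : ℝ} (hx : x ≠ 0) :
    HasDerivAt (truncPowExp a k) (truncPow k x - a * truncPowExp a k x) x := by
  rcases hx.lt_or_gt with hx | hx
  · rw [truncPow_of_neg k hx, truncPowExp_of_neg a k hx, mul_zero, sub_zero]
    refine (hasDerivAt_const x (0 : ℝ)).congr_of_eventuallyEq ?_
    filter_upwards [gt_mem_nhds hx] with y hy using truncPowExp_of_neg a k hy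
  · have h1 : HasDerivAt (fun y : ℝ => -(y * a)) (-a) x := by
      simpa using hasDerivAt_mul_const a |>.fun_neg
    have h2 := ((hasDerivAt_cutexp_succ k (-(x * a))).comp x h1).div_const ((-a) ^ (k + 1))
    refine (h2.congr_of_eventuallyEq (f₁ := truncPowExp a k) ?_).congr_deriv ?_
    · filter_upwards [lt_mem_nhds hx] with y hy using if_pos hy.le
    · have hk : (Nat.factorial k : ℝ) ≠ 0 := by positivity
      have hp : (-a) ^ k ≠ 0 := pow_ne_zero _ (neg_ne_zero.2 ha)
      rw [truncPow, truncPowExp, if_pos hx.le, if_pos hx.le, cutexp_succ,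
        show -(x * a) = x * -a by ring, mul_pow, pow_succ]
      field_simp
      ring

lemma intervalIntegrable_exp_mul_truncPow (a : ℝ) (k : ℕ) (x u v : ℝ) :
    IntervalIntegrable (fun ρ => Real.exp (-(a * ρ)) * truncPow k (x - ρ)) volume u v := by
  have h : Antitone fun ρ => truncPow k (x - ρ) :=
    fun _ _ h => monotone_truncPow k (sub_le_sub_left h x)
  exact h.intervalIntegrable.continuousOn_mul (by fun_prop)

lemma integral_exp_mul_truncPow {a : ℝ} (ha : a ≠ 0) (k : ℕ) (x ξ : ℝ) :
    ∫ ρ in (0 : ℝ)..ξ, Real.exp (-(a * ρ)) * truncPow k (x - ρ) =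
      truncPowExp a k x - Real.exp (-(a * ξ)) * truncPowExp a k (x - ξ) := by
  have hc := continuous_truncPowExp a k
  rw [integral_eq_of_hasDerivAt_off_countable
    (fun ρ => -(Real.exp (-(a * ρ)) * truncPowExp a k (x - ρ))) _ (Set.countable_singleton x)
    (by fun_prop) ?_ (intervalIntegrable_exp_mul_truncPow a k x 0 ξ)]
  · simp
    ring
  · rintro ρ ⟨-, hρ⟩
    have h1 : HasDerivAt (fun ρ : ℝ => Real.exp (-(a * ρ))) (Real.exp (-(a * ρ)) * -a) ρ := by
      simpa using ((hasDerivAt_id ρ).const_mul a).neg.exp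
    have h2 := (hasDerivAt_truncPowExp ha k (sub_ne_zero.2 (Ne.symm hρ))).comp ρ
      ((hasDerivAt_id ρ).const_sub x)
    refine (h1.mul h2).neg.congr_deriv ?_
    simp only [Function.comp_apply]
    ring

lemma sum_choose_mul_sub (n : ℕ) (f : ℕ → ℝ) :
    ∑ i ∈ Finset.range (n + 1), (n.choose i : ℝ) * (-1) ^ i * (f i - f (i + 1)) =
      ∑ i ∈ Finset.range (n + 2), ((n + 1).choose i : ℝ) * (-1) ^ i * f i := by
  have h : ∑ i ∈ Finset.range (n + 1), (n.choose i : ℝ) * (-1) ^ i * f i =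
      ∑ i ∈ Finset.range (n + 2), (n.choose i : ℝ) * (-1) ^ i * f i := by
    simp [Finset.sum_range_succ _ (n + 1)]
  simp only [mul_sub, Finset.sum_sub_distrib]
  rw [h, Finset.sum_range_succ', Finset.sum_range_succ' _ (n + 1), add_sub_right_comm,
    ← Finset.sum_sub_distrib]
  congr 1
  · refine Finset.sum_congr rfl fun i _ => ?_
    rw [Nat.choose_succ_succ]
    push_cast
    ring
  · simp

lemma hill_succ_eq_sum (k : ℕ) (x : ℝ) :
    hill (k + 1) x = ∑ i ∈ Finset.range (k + 2),
      ((k + 1).choose i : ℝ) * (-1) ^ i * truncPow k (x - i) := by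
  induction k generalizing x with
  | zero =>
    simp only [hill, truncPow, Finset.sum_range_succ, Finset.sum_range_zero]
    split_ifs <;> simp_all <;> linarith
  | succ k ih =>
    have hint : ∀ i ∈ Finset.range (k + 2), IntervalIntegrable
        (fun ρ => ((k + 1).choose i : ℝ) * (-1) ^ i * truncPow k (ρ - i)) volume (x - 1) x := by
      intro i _
      have h : Monotone fun ρ => truncPow k (ρ - i) :=
        fun _ _ h => monotone_truncPow k (sub_le_sub_right h _)
      exact h.intervalIntegrable.const_mul _
    rw [hill]
    simp_rw [ih]
    rw [intervalIntegral.integral_finsetSum hint,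
      ← sum_choose_mul_sub (k + 1) fun i => truncPow (k + 1) (x - i)]
    refine Finset.sum_congr rfl fun i _ => ?_
    rw [intervalIntegral.integral_const_mul,
      intervalIntegral.integral_comp_sub_right (truncPow k), integral_truncPow,
      show x - 1 - i = x - (i + 1 : ℕ) by push_cast; ring]

theorem hill_exp_integral (a : ℝ) (ha : 0 < a) (k : ℕ) (hk : 1 ≤ k)
    (ξ : ℝ) (hξ : 0 ≤ ξ) :
    (∫ ρ in (0:ℝ)..ξ, Real.exp (-(a * ρ)) * hill k (ξ - ρ)) =
      ∑ i ∈ Finset.range (⌊ξ⌋₊ + 1),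
        (k.choose i : ℝ) * (-1 : ℝ) ^ i * cutexp k (-((ξ - (i : ℝ)) * a)) / (-a) ^ k := by
  obtain ⟨k, rfl⟩ := Nat.exists_eq_add_of_le' hk
  have hterm (i : ℕ) : ∫ ρ in (0 : ℝ)..ξ, Real.exp (-(a * ρ)) * truncPow k (ξ - i - ρ) =
      truncPowExp a k (ξ - i) := by
    rw [integral_exp_mul_truncPow ha.ne', sub_sub_cancel_left, sub_eq_self]
    rcases Nat.eq_zero_or_pos i with rfl | hi
    · simp [truncPowExp, cutexp_succ_zero]
    · rw [truncPowExp_of_neg a k (neg_lt_zero.2 (Nat.cast_pos.2 hi)), mul_zero]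
  have hleft : ∫ ρ in (0 : ℝ)..ξ, Real.exp (-(a * ρ)) * hill (k + 1) (ξ - ρ) =
      ∑ i ∈ Finset.range (k + 2),
        ((k + 1).choose i : ℝ) * (-1) ^ i * truncPowExp a k (ξ - i) := by
    have hint : ∀ i ∈ Finset.range (k + 2), IntervalIntegrable (fun ρ =>
        ((k + 1).choose i : ℝ) * (-1) ^ i * (Real.exp (-(a * ρ)) * truncPow k (ξ - i - ρ)))
        volume 0 ξ :=
      fun i _ => (intervalIntegrable_exp_mul_truncPow a k (ξ - i) 0 ξ).const_mul _
    simp_rw [hill_succ_eq_sum, Finset.mul_sum, mul_left_comm (Real.exp _),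
      sub_right_comm ξ _ (Nat.cast _)]
    rw [intervalIntegral.integral_finsetSum hint]
    simp_rw [intervalIntegral.integral_const_mul, hterm]
  have hright : ∑ i ∈ Finset.range (⌊ξ⌋₊ + 1), ((k + 1).choose i : ℝ) * (-1 : ℝ) ^ i *
        cutexp (k + 1) (-((ξ - (i : ℝ)) * a)) / (-a) ^ (k + 1) =
      ∑ i ∈ Finset.range (⌊ξ⌋₊ + 1),
        ((k + 1).choose i : ℝ) * (-1) ^ i * truncPowExp a k (ξ - i) := by
    refine Finset.sum_congr rfl fun i hi => ?_
    have hi' : (i : ℝ) ≤ ξ := (Nat.le_floor_iff hξ).1 (Finset.mem_range_succ_iff.1 hi)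
    rw [truncPowExp, if_pos (sub_nonneg.2 hi'), mul_div_assoc]
  rw [hleft, hright]
  trans ∑ i ∈ Finset.range (k + 2 + (⌊ξ⌋₊ + 1)),
    ((k + 1).choose i : ℝ) * (-1) ^ i * truncPowExp a k (ξ - i)
  · refine Finset.sum_subset (Finset.range_mono (Nat.le_add_right _ _)) fun i _ hi => ?_
    rw [Nat.choose_eq_zero_of_lt (not_lt.1 (Finset.mem_range.not.1 hi))]
    simp
  · refine (Finset.sum_subset (Finset.range_mono (Nat.le_add_left _ _)) fun i _ hi => ?_).symm
    have hi' : ξ < i := (Nat.floor_lt hξ).1 (by simpa using hi)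
    rw [truncPowExp_of_neg a k (sub_neg.2 hi'), mul_zero]
end

section
/- Let B > 1, α > 0 and k ≥ 1 an integer. Then λ̃_norm^k(0) = 0, λ̃_norm^k(k) = ((1 − B^{−α})/(α·ln B))^k, and there exists ξ_½ ∈ (0, k] with ξ_½ ≥ k/2 such that λ̃_norm^k is monotone increasing on (0, ξ_½) and monotone decreasing on (ξ_½, k). -/
open MeasureTheory

/-- The normalized function `λ̃_norm^k(ξ) = ∫_0^ξ B^{-ρα} m^k(ξ-ρ) dρ` (and `0` for `ξ < 0`). -/
noncomputable def lamNorm (B α : ℝ) (k : ℕ) (ξ : ℝ) : ℝ :=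
  if 0 ≤ ξ then ∫ ρ in (0:ℝ)..ξ, B ^ (-(ρ * α)) * hill k (ξ - ρ) else 0

section Exponential

variable {c : ℝ}

theorem integral_mul_exp_mul (c u v : ℝ) :
    ∫ s in u..v, c * Real.exp (c * s) = Real.exp (c * v) - Real.exp (c * u) := by
  refine intervalIntegral.integral_eq_sub_of_hasDerivAt (f := fun s => Real.exp (c * s))
    (fun x _ => ?_) (Continuous.intervalIntegrable (by fun_prop) _ _)
  have h := ((hasDerivAt_id' x).const_mul c).exp
  exact h.congr_deriv (by ring)

theorem mul_integral_exp_mul_eq (c : ℝ) (f : ℝ → ℝ) (u v : ℝ) :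
    c * ∫ s in u..v, Real.exp (c * s) * f s = ∫ s in u..v, c * Real.exp (c * s) * f s := by
  rw [← intervalIntegral.integral_const_mul]
  simp only [mul_assoc]

theorem mul_integral_exp_mul_le {f : ℝ → ℝ} (hc : 0 < c) (hf : Continuous f) {u v y : ℝ}
    (huv : u ≤ v) (h : ∀ s ∈ Set.Icc u v, f s ≤ y) :
    c * ∫ s in u..v, Real.exp (c * s) * f s ≤ (Real.exp (c * v) - Real.exp (c * u)) * y := by
  rw [mul_integral_exp_mul_eq, ← integral_mul_exp_mul, ← intervalIntegral.integral_mul_const]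
  refine intervalIntegral.integral_mono_on huv
    (Continuous.intervalIntegrable (by fun_prop) _ _)
    (Continuous.intervalIntegrable (by fun_prop) _ _) fun s hs => ?_
  have := h s hs
  gcongr

theorem le_mul_integral_exp_mul {f : ℝ → ℝ} (hc : 0 < c) (hf : Continuous f) {u v y : ℝ}
    (huv : u ≤ v) (h : ∀ s ∈ Set.Icc u v, y ≤ f s) :
    (Real.exp (c * v) - Real.exp (c * u)) * y ≤ c * ∫ s in u..v, Real.exp (c * s) * f s := by
  rw [mul_integral_exp_mul_eq, ← integral_mul_exp_mul, ← intervalIntegral.integral_mul_const]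
  refine intervalIntegral.integral_mono_on huv
    (Continuous.intervalIntegrable (by fun_prop) _ _)
    (Continuous.intervalIntegrable (by fun_prop) _ _) fun s hs => ?_
  have := h s hs
  gcongr

/-- The exponential average `∫_0^x e^{-c(x-s)} f(s) ds`. -/
noncomputable def expAverage (c : ℝ) (f : ℝ → ℝ) (x : ℝ) : ℝ :=
  Real.exp (-(c * x)) * ∫ s in (0:ℝ)..x, Real.exp (c * s) * f s

theorem hasDerivAt_expAverage {f : ℝ → ℝ} (hf : Continuous f) (x : ℝ) :
    HasDerivAt (expAverage c f) (f x - c * expAverage c f x) x := by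
  have hg : Continuous fun s => Real.exp (c * s) * f s := by fun_prop
  have h1 := hg.integral_hasStrictDerivAt 0 x |>.hasDerivAt
  have h2 := ((hasDerivAt_id' x).const_mul c).neg.exp
  have h3 := h2.mul h1
  have h4 : Real.exp (-(c * x)) * Real.exp (c * x) = 1 := by
    rw [← Real.exp_add]; simp
  refine HasDerivAt.congr_deriv (f := expAverage c f) h3 ?_
  simp only [expAverage, Pi.neg_apply]
  linear_combination f x * h4

theorem exp_mul_expAverage (f : ℝ → ℝ) (x : ℝ) :
    Real.exp (c * x) * expAverage c f x = ∫ s in (0:ℝ)..x, Real.exp (c * s) * f s := by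
  rw [expAverage, ← mul_assoc, ← Real.exp_add]
  simp

theorem mul_expAverage_le {f : ℝ → ℝ} (hc : 0 < c) (hf : Continuous f) (hf0 : ∀ x, 0 ≤ f x)
    {a x : ℝ} (hmono : MonotoneOn f (Set.Iic a)) (hx0 : 0 ≤ x) (hxa : x ≤ a) :
    c * expAverage c f x ≤ f x := by
  have h1 := mul_integral_exp_mul_le hc hf hx0
    (fun s hs => hmono (hs.2.trans hxa) hxa hs.2)
  rw [← exp_mul_expAverage] at h1
  have h2 := Real.exp_pos (c * x)
  have h3 := mul_nonneg (Real.exp_pos (c * 0)).le (hf0 x)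
  refine le_of_mul_le_mul_left ?_ h2
  linarith

theorem le_mul_expAverage_of_le {f : ℝ → ℝ} (hc : 0 < c) (hf : Continuous f)
    {a x y : ℝ} (hanti : AntitoneOn f (Set.Ici a)) (hax : a ≤ x) (hxy : x ≤ y)
    (hx : f x ≤ c * expAverage c f x) : f y ≤ c * expAverage c f y := by
  have h1 := le_mul_integral_exp_mul hc hf hxy
    (fun s hs => hanti (hax.trans hs.1) (hax.trans hxy) hs.2)
  have hg : Continuous fun s => Real.exp (c * s) * f s := by fun_prop
  have h2 := intervalIntegral.integral_add_adjacent_intervals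
    (hg.intervalIntegrable (μ := volume) 0 x) (hg.intervalIntegrable x y)
  rw [← exp_mul_expAverage, ← exp_mul_expAverage] at h2
  have h3 : f y ≤ f x := hanti hax (hax.trans hxy) hxy
  have h4 := mul_le_mul_of_nonneg_left (h3.trans hx) (Real.exp_pos (c * x)).le
  refine le_of_mul_le_mul_left ?_ (Real.exp_pos (c * y))
  linear_combination h1 + h4 + c * h2

/-- The exponential average of a continuous unimodal function vanishing at `b` is unimodal
on `[0, b]`, and its mode lies to the right of that of the function. -/
theorem exists_mode_expAverage {f : ℝ → ℝ} (hc : 0 < c) (hf : Continuous f) (hf0 : ∀ x, 0 ≤ f x)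
    {a b : ℝ} (ha : 0 ≤ a) (hab : a ≤ b) (hmono : MonotoneOn f (Set.Iic a))
    (hanti : AntitoneOn f (Set.Ici a)) (hb : f b = 0) :
    ∃ x ∈ Set.Icc a b, MonotoneOn (expAverage c f) (Set.Icc 0 x) ∧
      AntitoneOn (expAverage c f) (Set.Icc x b) := by
  have hD := fun x => hasDerivAt_expAverage (c := c) hf x
  have hcont : Continuous (expAverage c f) :=
    continuous_iff_continuousAt.2 fun x => (hD x).continuousAt
  set S : Set ℝ := {x | x ∈ Set.Icc a b ∧ f x ≤ c * expAverage c f x} with hS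
  have hbS : b ∈ S := by
    refine ⟨Set.right_mem_Icc.2 hab, ?_⟩
    rw [hb]
    refine mul_nonneg hc.le (mul_nonneg (Real.exp_pos _).le ?_)
    exact intervalIntegral.integral_nonneg (ha.trans hab)
      fun s _ => mul_nonneg (Real.exp_pos _).le (hf0 s)
  have hbdd : BddBelow S := ⟨a, fun x hx => hx.1.1⟩
  have hax : a ≤ sInf S := le_csInf ⟨b, hbS⟩ fun x hx => hx.1.1
  refine ⟨sInf S, ⟨hax, csInf_le hbdd hbS⟩, ?_, ?_⟩
  · refine monotoneOn_of_deriv_nonneg (convex_Icc _ _) hcont.continuousOn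
      (fun x _ => (hD x).differentiableAt.differentiableWithinAt) fun x hx => ?_
    rw [interior_Icc] at hx
    rw [(hD x).deriv, sub_nonneg]
    rcases le_total x a with h | h
    · exact mul_expAverage_le hc hf hf0 hmono hx.1.le h
    · by_contra! hlt
      exact notMem_of_lt_csInf hx.2 hbdd
        ⟨⟨h, hx.2.le.trans (csInf_le hbdd hbS)⟩, hlt.le⟩
  · refine antitoneOn_of_deriv_nonpos (convex_Icc _ _) hcont.continuousOn
      (fun x _ => (hD x).differentiableAt.differentiableWithinAt) fun x hx => ?_
    rw [interior_Icc] at hx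
    rw [(hD x).deriv, sub_nonpos]
    obtain ⟨y, hy, hyx⟩ := exists_lt_of_csInf_lt ⟨b, hbS⟩ hx.1
    exact le_mul_expAverage_of_le hc hf hanti hy.1.1 hyx.le hy.2

end Exponential

section Hill

theorem hill_one_eq_indicator : hill 1 = Set.indicator (Set.Ico 0 1) 1 := by
  funext x
  simp [hill, Set.indicator_apply]

theorem hill_succ {k : ℕ} (hk : 1 ≤ k) (x : ℝ) :
    hill (k + 1) x = ∫ ρ in (x - 1)..x, hill k ρ := by
  obtain ⟨k, rfl⟩ := Nat.exists_eq_add_of_le' hk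
  rfl

theorem hill_nonneg (k : ℕ) (x : ℝ) : 0 ≤ hill k x := by
  rcases k with _ | k
  · exact le_rfl
  induction k generalizing x with
  | zero =>
    rw [hill_one_eq_indicator]
    exact Set.indicator_nonneg (fun _ _ => zero_le_one) x
  | succ k ih =>
    rw [hill_succ (by omega)]
    exact intervalIntegral.integral_nonneg (by linarith) fun s _ => ih s

theorem hill_eq_zero_of_neg (k : ℕ) {x : ℝ} (hx : x < 0) : hill k x = 0 := by
  rcases k with _ | k
  · rfl
  induction k generalizing x with
  | zero => simp [hill, hx]
  | succ k ih =>
    rw [hill_succ (by omega)]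
    refine intervalIntegral.integral_zero_ae (.of_forall fun s hs => ih ?_)
    rw [Set.uIoc_of_le (by linarith)] at hs
    exact hs.2.trans_lt hx

theorem hill_eq_zero_of_le (k : ℕ) {x : ℝ} (hx : k ≤ x) : hill k x = 0 := by
  rcases k with _ | k
  · rfl
  induction k generalizing x with
  | zero => simp_all [hill]
  | succ k ih =>
    rw [hill_succ (by omega)]
    refine intervalIntegral.integral_zero_ae (.of_forall fun s hs => ih ?_)
    rw [Set.uIoc_of_le (by linarith)] at hs
    push_cast at hx ⊢
    linarith [hs.1]

theorem continuous_integral_sub_one {f : ℝ → ℝ}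
    (hf : ∀ a b, IntervalIntegrable f volume a b) :
    Continuous fun x : ℝ => ∫ s in (x - 1)..x, f s := by
  have h := intervalIntegral.continuous_primitive hf 0
  have h2 : (fun x : ℝ => ∫ s in (x - 1)..x, f s) =
      fun x => (∫ s in (0:ℝ)..x, f s) - ∫ s in (0:ℝ)..(x - 1), f s := by
    funext x
    rw [intervalIntegral.integral_interval_sub_left (hf _ _) (hf _ _)]
  rw [h2]
  exact h.sub (h.comp (continuous_id.sub continuous_const))

theorem intervalIntegrable_hill (k : ℕ) (a b : ℝ) : IntervalIntegrable (hill k) volume a b := by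
  rcases k with _ | k
  · exact intervalIntegrable_const (c := (0 : ℝ))
  induction k generalizing a b with
  | zero =>
    rw [hill_one_eq_indicator]
    refine Integrable.intervalIntegrable ?_
    exact (integrable_indicator_iff measurableSet_Ico).2 (integrableOn_const (by simp))
  | succ k ih =>
    have h := continuous_integral_sub_one ih
    exact h.intervalIntegrable a b

theorem continuous_hill {k : ℕ} (hk : 2 ≤ k) : Continuous (hill k) := by
  obtain ⟨k, rfl⟩ := Nat.exists_eq_add_of_le' hk
  exact continuous_integral_sub_one (intervalIntegrable_hill (k + 1))

theorem hill_succ_sub_of_ae {k : ℕ} (hk : 1 ≤ k)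
    (h : ∀ᵐ x : ℝ, hill k (k - x) = hill k x) (x : ℝ) :
    hill (k + 1) ((k + 1 : ℕ) - x) = hill (k + 1) x := by
  have h1 := intervalIntegral.integral_comp_sub_left (hill k) (k : ℝ) (a := x - 1) (b := x)
  rw [hill_succ hk, hill_succ hk]
  rw [intervalIntegral.integral_congr_ae (h.mono fun s hs _ => hs)] at h1
  rw [h1]
  push_cast
  congr 1 <;> ring

theorem ae_hill_sub (k : ℕ) : ∀ᵐ x : ℝ, hill k (k - x) = hill k x := by
  rcases k with _ | k
  · exact .of_forall fun _ => rfl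
  induction k with
  | zero =>
    have h0 : ∀ᵐ x : ℝ, x ≠ 0 := Measure.ae_ne volume 0
    have h1 : ∀ᵐ x : ℝ, x ≠ 1 := Measure.ae_ne volume 1
    filter_upwards [h0, h1] with x hx0 hx1
    simp only [hill]
    have : (0 ≤ ((0 + 1 : ℕ) : ℝ) - x ∧ ((0 + 1 : ℕ) : ℝ) - x < 1) ↔ (0 ≤ x ∧ x < 1) := by
      push_cast
      constructor
      · rintro ⟨h, h'⟩
        exact ⟨by linarith, lt_of_le_of_ne (by linarith) hx1⟩
      · rintro ⟨h, h'⟩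
        have := lt_of_le_of_ne h (Ne.symm hx0)
        exact ⟨by linarith, by linarith⟩
    simp only [this]
  | succ k ih => exact .of_forall (hill_succ_sub_of_ae (by omega) ih)

theorem hill_sub {k : ℕ} (hk : 2 ≤ k) (x : ℝ) : hill k (k - x) = hill k x := by
  obtain ⟨k, rfl⟩ := Nat.exists_eq_add_of_le' hk
  exact hill_succ_sub_of_ae (by omega) (ae_hill_sub (k + 1)) x

theorem antitoneOn_hill_succ_of_le {k : ℕ} (hk : 1 ≤ k)
    (h : ∀ s : ℝ, ((k + 1 : ℕ) : ℝ) / 2 ≤ s → hill k s ≤ hill k (s - 1)) :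
    AntitoneOn (hill (k + 1)) (Set.Ici (((k + 1 : ℕ) : ℝ) / 2)) := by
  intro x hx y _ hxy
  have hi := intervalIntegrable_hill k
  have h1 : ∫ s in x..y, hill k s ≤ ∫ s in x..y, hill k (s - 1) :=
    intervalIntegral.integral_mono_on hxy (hi _ _)
      (by simpa using (hi (x - 1) (y - 1)).comp_sub_right 1)
      fun s hs => h s (le_trans hx hs.1)
  rw [intervalIntegral.integral_comp_sub_right] at h1
  rw [hill_succ hk, hill_succ hk]
  have h2 := intervalIntegral.integral_add_adjacent_intervals (hi (x - 1) (y - 1)) (hi (y - 1) y)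
  have h3 := intervalIntegral.integral_add_adjacent_intervals (hi (x - 1) x) (hi x y)
  linarith

theorem hill_le_hill_sub_one {k : ℕ} (hk : 1 ≤ k) {s : ℝ} (hs : ((k + 1 : ℕ) : ℝ) / 2 ≤ s) :
    hill k s ≤ hill k (s - 1) := by
  induction k, hk using Nat.le_induction generalizing s with
  | base =>
    rw [hill_eq_zero_of_le 1 (by push_cast at hs ⊢; linarith)]
    exact hill_nonneg _ _
  | succ k hk ih =>
    have hanti := antitoneOn_hill_succ_of_le hk fun s hs => ih hs
    push_cast at hs
    rcases le_total (((k + 1 : ℕ) : ℝ) / 2) (s - 1) with h | h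
    · exact hanti h (h.trans (by linarith)) (by linarith)
    · rw [← hill_sub (by omega) (s - 1)]
      push_cast at h
      refine hanti (Set.mem_Ici.2 ?_) (Set.mem_Ici.2 ?_) ?_ <;> push_cast <;> linarith

theorem antitoneOn_hill {k : ℕ} (hk : 2 ≤ k) : AntitoneOn (hill k) (Set.Ici ((k : ℝ) / 2)) := by
  obtain ⟨k, rfl⟩ := Nat.exists_eq_add_of_le' hk
  exact antitoneOn_hill_succ_of_le (by omega) fun s hs => hill_le_hill_sub_one (by omega) hs

theorem monotoneOn_hill {k : ℕ} (hk : 2 ≤ k) : MonotoneOn (hill k) (Set.Iic ((k : ℝ) / 2)) := by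
  intro x hx y hy hxy
  rw [← hill_sub hk x, ← hill_sub hk y]
  simp only [Set.mem_Iic] at hx hy
  refine antitoneOn_hill hk (Set.mem_Ici.2 ?_) (Set.mem_Ici.2 ?_) ?_ <;> linarith

end Hill

section Laplace

variable {c : ℝ}

theorem hill_succ_eq_integral_sub {k : ℕ} (hk : 1 ≤ k) (x : ℝ) :
    hill (k + 1) x = ∫ t in (0:ℝ)..1, hill k (x - t) := by
  rw [hill_succ hk, intervalIntegral.integral_comp_sub_left, sub_zero]

theorem integral_exp_neg_mul_zero_one (hc : c ≠ 0) :
    ∫ s in (0:ℝ)..1, Real.exp (-(c * s)) = (1 - Real.exp (-c)) / c := by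
  have h := integral_mul_exp_mul (-c) 0 1
  rw [intervalIntegral.integral_const_mul] at h
  simp only [neg_mul, mul_one, mul_zero, Real.exp_zero] at h
  rw [eq_div_iff hc]
  linarith

theorem integrableOn_exp_neg_mul_Ioc (c : ℝ) :
    Integrable ((Set.Ioc (0:ℝ) 1).indicator fun s => Real.exp (-(c * s))) := by
  rw [integrable_indicator_iff measurableSet_Ioc]
  exact (Continuous.integrableOn_Icc (by fun_prop)).mono_set Set.Ioc_subset_Icc_self

open scoped Convolution in
theorem exp_neg_mul_hill_succ_eq_convolution (c : ℝ) {k : ℕ} (hk : 1 ≤ k) :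
    (fun x => Real.exp (-(c * x)) * hill (k + 1) x) =
      ((Set.Ioc (0:ℝ) 1).indicator fun s => Real.exp (-(c * s))) ⋆[ContinuousLinearMap.mul ℝ ℝ]
        fun x => Real.exp (-(c * x)) * hill k x := by
  funext x
  rw [convolution_def, hill_succ_eq_integral_sub hk, ← intervalIntegral.integral_const_mul,
    intervalIntegral.integral_of_le zero_le_one, ← integral_indicator measurableSet_Ioc]
  congr 1
  funext t
  by_cases ht : t ∈ Set.Ioc (0:ℝ) 1
  · simp only [Set.indicator_of_mem ht, ContinuousLinearMap.mul_apply']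
    rw [← mul_assoc, ← Real.exp_add]
    ring_nf
  · simp [Set.indicator_of_notMem ht]

theorem exp_neg_mul_hill_one (c : ℝ) :
    (fun x => Real.exp (-(c * x)) * hill 1 x) =ᵐ[volume]
      (Set.Ioc (0:ℝ) 1).indicator fun s => Real.exp (-(c * s)) := by
  have h : (Set.Ico (0:ℝ) 1).indicator (fun s => Real.exp (-(c * s))) =ᵐ[volume]
      (Set.Ioc (0:ℝ) 1).indicator fun s => Real.exp (-(c * s)) :=
    indicator_ae_eq_of_ae_eq_set Ico_ae_eq_Ioc
  refine Filter.EventuallyEq.trans (.of_forall fun x => ?_) h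
  simp [hill_one_eq_indicator, Set.indicator_apply]

theorem integrable_exp_neg_mul_hill (c : ℝ) {k : ℕ} (hk : 1 ≤ k) :
    Integrable fun x => Real.exp (-(c * x)) * hill k x := by
  induction k, hk using Nat.le_induction with
  | base => exact (integrableOn_exp_neg_mul_Ioc c).congr (exp_neg_mul_hill_one c).symm
  | succ k hk ih =>
    rw [exp_neg_mul_hill_succ_eq_convolution c hk]
    exact (integrableOn_exp_neg_mul_Ioc c).integrable_convolution _ ih

theorem integral_exp_neg_mul_hill (hc : c ≠ 0) {k : ℕ} (hk : 1 ≤ k) :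
    ∫ x, Real.exp (-(c * x)) * hill k x = ((1 - Real.exp (-c)) / c) ^ k := by
  have h1 : ∫ x, (Set.Ioc (0:ℝ) 1).indicator (fun s => Real.exp (-(c * s))) x =
      (1 - Real.exp (-c)) / c := by
    rw [integral_indicator measurableSet_Ioc, ← intervalIntegral.integral_of_le zero_le_one,
      integral_exp_neg_mul_zero_one hc]
  induction k, hk using Nat.le_induction with
  | base => rw [integral_congr_ae (exp_neg_mul_hill_one c), h1, pow_one]
  | succ k hk ih =>
    rw [exp_neg_mul_hill_succ_eq_convolution c hk,
      integral_convolution _ (integrableOn_exp_neg_mul_Ioc c) (integrable_exp_neg_mul_hill c hk),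
      h1, ih, ContinuousLinearMap.mul_apply', pow_succ']

end Laplace

section LamNorm

variable {B α : ℝ}

theorem rpow_neg_mul_eq_exp (hB : 0 < B) (α ρ : ℝ) :
    B ^ (-(ρ * α)) = Real.exp (-(α * Real.log B * ρ)) := by
  rw [Real.rpow_def_of_pos hB]
  ring_nf

theorem lamNorm_eq_integral (hB : 0 < B) (k : ℕ) {x : ℝ} (hx : 0 ≤ x) :
    lamNorm B α k x =
      ∫ ρ in (0:ℝ)..x, Real.exp (-(α * Real.log B * ρ)) * hill k (x - ρ) := by
  simp only [lamNorm, if_pos hx, rpow_neg_mul_eq_exp hB]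

theorem lamNorm_zero (B α : ℝ) (k : ℕ) : lamNorm B α k 0 = 0 := by
  simp [lamNorm]

theorem lamNorm_eq_expAverage (hB : 0 < B) (k : ℕ) {x : ℝ} (hx : 0 ≤ x) :
    lamNorm B α k x = expAverage (α * Real.log B) (hill k) x := by
  have h := intervalIntegral.integral_comp_sub_left (a := 0) (b := x)
    (fun s => Real.exp (-(α * Real.log B * (x - s))) * hill k s) x
  simp only [sub_sub_cancel, sub_self, sub_zero] at h
  rw [lamNorm_eq_integral hB k hx, h, expAverage, ← intervalIntegral.integral_const_mul]
  congr 1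
  funext s
  rw [← mul_assoc, ← Real.exp_add]
  ring_nf

theorem lamNorm_natCast (hB : 1 < B) (hα : 0 < α) {k : ℕ} (hk : 1 ≤ k) :
    lamNorm B α k k = ((1 - B ^ (-α)) / (α * Real.log B)) ^ k := by
  have hB0 : 0 < B := zero_lt_one.trans hB
  have hc : α * Real.log B ≠ 0 := (mul_pos hα (Real.log_pos hB)).ne'
  have hpow : B ^ (-α) = Real.exp (-(α * Real.log B)) := by
    simpa using rpow_neg_mul_eq_exp hB0 α 1
  rw [lamNorm_eq_integral hB0 k k.cast_nonneg, hpow, ← integral_exp_neg_mul_hill hc hk,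
    intervalIntegral.integral_congr_ae
      ((ae_hill_sub k).mono fun s hs _ => congrArg (Real.exp (-(α * Real.log B * s)) * ·) hs),
    intervalIntegral.integral_of_le k.cast_nonneg, ← integral_Icc_eq_integral_Ioc]
  refine setIntegral_eq_integral_of_forall_compl_eq_zero fun s hs => ?_
  rw [Set.mem_Icc, not_and_or, not_le, not_le] at hs
  rcases hs with hs | hs
  · rw [hill_eq_zero_of_neg k hs, mul_zero]
  · rw [hill_eq_zero_of_le k hs.le, mul_zero]

theorem lamNorm_one_eq_integral (hB : 0 < B) {x : ℝ} (hx : x ∈ Set.Ioo (0 : ℝ) 1) :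
    lamNorm B α 1 x = ∫ ρ in (0:ℝ)..x, Real.exp (-(α * Real.log B * ρ)) := by
  rw [lamNorm_eq_integral hB 1 hx.1.le]
  refine intervalIntegral.integral_congr fun s hs => ?_
  rw [Set.uIcc_of_le hx.1.le] at hs
  have h : 0 ≤ x - s ∧ x - s < 1 := ⟨by linarith [hs.2], by linarith [hs.1, hx.2]⟩
  simp only [hill, if_pos h, mul_one]

theorem monotoneOn_lamNorm_one (hB : 0 < B) : MonotoneOn (lamNorm B α 1) (Set.Ioo 0 1) := by
  intro x hx y hy hxy
  rw [lamNorm_one_eq_integral hB hx, lamNorm_one_eq_integral hB hy]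
  exact intervalIntegral.integral_mono_interval le_rfl hx.1.le hxy
    (.of_forall fun s => (Real.exp_pos _).le) (Continuous.intervalIntegrable (by fun_prop) _ _)

end LamNorm

theorem lamNorm_shape (B α : ℝ) (hB : 1 < B) (hα : 0 < α) (k : ℕ) (hk : 1 ≤ k) :
    lamNorm B α k 0 = 0 ∧
    lamNorm B α k k = ((1 - B ^ (-α)) / (α * Real.log B)) ^ k ∧
    ∃ ξh : ℝ, ξh ∈ Set.Ioc (0 : ℝ) (k : ℝ) ∧ (k : ℝ) / 2 ≤ ξh ∧
      MonotoneOn (lamNorm B α k) (Set.Ioo 0 ξh) ∧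
      AntitoneOn (lamNorm B α k) (Set.Ioo ξh (k : ℝ)) := by
  have hB0 : 0 < B := zero_lt_one.trans hB
  refine ⟨lamNorm_zero B α k, lamNorm_natCast hB hα hk, ?_⟩
  rcases hk.eq_or_lt with rfl | hk2
  · refine ⟨1, by simp, by norm_num, monotoneOn_lamNorm_one hB0, ?_⟩
    simp [AntitoneOn]
  · have hk0 : (0 : ℝ) < k := by exact_mod_cast hk
    obtain ⟨x, hx, hmono, hanti⟩ := exists_mode_expAverage
      (mul_pos hα (Real.log_pos hB)) (continuous_hill hk2) (hill_nonneg k)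
      (half_pos hk0).le (half_le_self hk0.le) (monotoneOn_hill hk2) (antitoneOn_hill hk2)
      (hill_eq_zero_of_le k le_rfl)
    have hx0 : 0 < x := (half_pos hk0).trans_le hx.1
    refine ⟨x, ⟨hx0, hx.2⟩, hx.1, ?_, ?_⟩
    · exact (hmono.mono Set.Ioo_subset_Icc_self).congr
        fun y hy => (lamNorm_eq_expAverage hB0 k hy.1.le).symm
    · exact (hanti.mono Set.Ioo_subset_Icc_self).congr
        fun y hy => (lamNorm_eq_expAverage hB0 k (hx0.trans hy.1).le).symm
end

section
/- Let B ≥ 3, α > 0 and C = B^{1+α}. Define c̃_0 = 1 and c̃_k = 1/(α·ln B) for k ≥ 1; ĉ_0 = 0, ĉ_1 = (2+α)·ln B/(8π·α·√B), ĉ_2 = (6+3α)/(8π·α²·√B) + ((4+3·ln B)/(8π·α·√B))·(c̃_1 + ĉ_1), and ĉ_k = ĉ_{k−1} + ((4+3·ln B)/(8π·α·√B))·(c̃_{k−1} + ĉ_{k−1}) for k ≥ 3. Then: (a) for every integer k ≥ 0 and every real x > 0, λ̂^k(x) ≤ ĉ_k·α^k·x; (b) if moreover α ≥ (ln B)/√B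 and (ln B)² ≤ √B, then ĉ_1 ≤ (1+α)·ln B/(α·√B) and ĉ_k ≤ (2^k − 1)·(1+α)/(α²·√B) for every k ≥ 2. -/
open MeasureTheory

/-- The error bound `Ê(t) = (1/(8π)) √t ln t` from the conditional prime number theorem. -/
noncomputable def Ehat (t : ℝ) : ℝ := 1 / (8 * Real.pi) * Real.sqrt t * Real.log t

/-- The simplified approximation `λ̃^k` (with `1/ln p` replaced by `1/ln B`). -/
noncomputable def lamtil (B C : ℝ) : ℕ → ℝ → ℝ
  | 0 => fun x => if 1 ≤ x then 1 else 0
  | k + 1 => fun x => (Real.log B)⁻¹ * ∫ p in B..C, lamtil B C k (x / p)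

/-- The simplified error bounding function `λ̂^k`. -/
noncomputable def lamhat (B C : ℝ) : ℕ → ℝ → ℝ
  | 0 => fun _ => 0
  | k + 1 => fun x =>
      (Real.log B)⁻¹ * (∫ p in B..C, lamhat B C k (x / p))
      + 2 * (lamtil B C k (x / B) + lamhat B C k (x / B)) * Ehat B
      + ∫ p in B..C, (lamtil B C k (x / p) + lamhat B C k (x / p)) * deriv Ehat p

/-- The constants `c̃_k`. -/
noncomputable def ctil (B α : ℝ) : ℕ → ℝ
  | 0 => 1
  | _ + 1 => 1 / (α * Real.log B)

/-- The constants `ĉ_k`. -/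
noncomputable def chat (B α : ℝ) : ℕ → ℝ
  | 0 => 0
  | 1 => (2 + α) * Real.log B / (8 * Real.pi * α * Real.sqrt B)
  | 2 => (6 + 3 * α) / (8 * Real.pi * α ^ 2 * Real.sqrt B)
      + (4 + 3 * Real.log B) / (8 * Real.pi * α * Real.sqrt B) * (ctil B α 1 + chat B α 1)
  | k + 3 => chat B α (k + 2)
      + (4 + 3 * Real.log B) / (8 * Real.pi * α * Real.sqrt B) * (ctil B α (k + 2) + chat B α (k + 2))

/-- An upper bound for the integral of a function dominated by a nonnegative derivative up to a
cutoff `D` and nonpositive beyond it; no integrability of `f` is required. -/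
theorem integral_le_of_le_deriv_of_cutoff {f g G : ℝ → ℝ} {a b D K : ℝ} (hab : a ≤ b) (hK : 0 ≤ K)
    (hG : ∀ p ∈ Set.Icc a b, HasDerivAt G (g p) p) (hg : ∀ p ∈ Set.Icc a b, 0 ≤ g p)
    (hfg : ∀ p ∈ Set.Icc a b, p ≤ D → f p ≤ g p) (hf : ∀ p ∈ Set.Icc a b, D < p → f p ≤ 0)
    (hGK : a ≤ D → G (min b D) - G a ≤ K) : ∫ p in a..b, f p ≤ K := by
  by_cases hi : IntervalIntegrable f volume a b
  swap
  · rwa [intervalIntegral.integral_undef hi]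
  rcases lt_or_ge D a with hD | hD
  · have h := intervalIntegral.integral_mono_on hab hi
      (intervalIntegrable_const (c := (0 : ℝ))) fun p hp => hf p hp (hD.trans_le hp.1)
    rw [intervalIntegral.integral_zero] at h
    exact h.trans hK
  have ham : a ≤ min b D := le_min hab hD
  have hmb : min b D ≤ b := min_le_left _ _
  have hm : ∀ p ∈ Set.Icc a (min b D), p ∈ Set.Icc a b := fun p hp => ⟨hp.1, hp.2.trans hmb⟩
  have hi₁ : IntervalIntegrable f volume a (min b D) :=
    hi.mono_set (by rw [Set.uIcc_of_le ham, Set.uIcc_of_le hab]; exact hm)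
  have hi₂ : IntervalIntegrable f volume (min b D) b :=
    hi.mono_set (by
      rw [Set.uIcc_of_le hmb, Set.uIcc_of_le hab]; exact fun p hp => ⟨ham.trans hp.1, hp.2⟩)
  have hgi : IntervalIntegrable g volume a (min b D) := by
    rw [intervalIntegrable_iff_integrableOn_Ioc_of_le ham]
    exact intervalIntegral.integrableOn_deriv_of_nonneg
      (fun p hp => (hG p (hm p hp)).continuousAt.continuousWithinAt)
      (fun p hp => hG p (hm p (Set.Ioo_subset_Icc_self hp)))
      (fun p hp => hg p (hm p (Set.Ioo_subset_Icc_self hp)))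
  have h₁ := intervalIntegral.integral_mono_on ham hi₁ hgi
    fun p hp => hfg p (hm p hp) (hp.2.trans (min_le_right _ _))
  rw [intervalIntegral.integral_eq_sub_of_hasDerivAt
    (fun p hp => hG p (hm p (by rwa [Set.uIcc_of_le ham] at hp))) hgi] at h₁
  have h₂ := intervalIntegral.integral_mono_on_of_le_Ioo hmb hi₂
    (intervalIntegrable_const (c := (0 : ℝ))) fun p hp => hf p ⟨ham.trans hp.1.le, hp.2.le⟩ (by
      rcases min_lt_iff.1 hp.1 with h | h
      · exact absurd hp.2 h.not_gt
      · exact h)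
  rw [intervalIntegral.integral_zero] at h₂
  rw [← intervalIntegral.integral_add_adjacent_intervals hi₁ hi₂]
  linarith [hGK hD]

theorem integral_le_of_le_deriv {f g G : ℝ → ℝ} {a b : ℝ} (hab : a ≤ b)
    (hG : ∀ p ∈ Set.Icc a b, HasDerivAt G (g p) p) (hg : ∀ p ∈ Set.Icc a b, 0 ≤ g p)
    (hfg : ∀ p ∈ Set.Icc a b, f p ≤ g p) : ∫ p in a..b, f p ≤ G b - G a := by
  have hmono : G a ≤ G b := by
    refine monotoneOn_of_hasDerivWithinAt_nonneg (convex_Icc a b)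
      (fun p hp => (hG p hp).continuousAt.continuousWithinAt)
      (fun p hp => (hG p (interior_subset hp)).hasDerivWithinAt)
      (fun p hp => hg p (interior_subset hp)) (Set.left_mem_Icc.2 hab) (Set.right_mem_Icc.2 hab) hab
  exact integral_le_of_le_deriv_of_cutoff (D := b) hab (sub_nonneg.2 hmono) hG hg
    (fun p hp _ => hfg p hp) (fun p hp h => absurd hp.2 h.not_ge) (by simp)

theorem hasDerivAt_Ehat {p : ℝ} (hp : 0 < p) :
    HasDerivAt Ehat ((Real.log p + 2) / (16 * Real.pi * √p)) p := by
  have h := (((Real.hasDerivAt_sqrt hp.ne').const_mul (1 / (8 * Real.pi))).mul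
    (Real.hasDerivAt_log hp.ne'))
  refine h.congr_deriv ?_
  obtain ⟨s, hs, rfl⟩ : ∃ s : ℝ, 0 < s ∧ p = s ^ 2 :=
    ⟨√p, Real.sqrt_pos.2 hp, (Real.sq_sqrt hp.le).symm⟩
  rw [Real.sqrt_sq hs.le]
  have := Real.pi_pos
  field_simp
  ring

theorem hasDerivAt_neg_log_add_four_div_sqrt {p : ℝ} (hp : 0 < p) :
    HasDerivAt (fun t => -((Real.log t + 4) / (8 * Real.pi * √t)))
      (1 / p * ((Real.log p + 2) / (16 * Real.pi * √p))) p := by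
  have hpi := Real.pi_pos
  have hsp := Real.sqrt_pos.2 hp
  have h := (((Real.hasDerivAt_log hp.ne').add_const 4).div
    ((Real.hasDerivAt_sqrt hp.ne').const_mul (8 * Real.pi)) (by positivity)).neg
  refine h.congr_deriv ?_
  obtain ⟨s, hs, rfl⟩ : ∃ s : ℝ, 0 < s ∧ p = s ^ 2 :=
    ⟨√p, Real.sqrt_pos.2 hp, (Real.sq_sqrt hp.le).symm⟩
  rw [Real.sqrt_sq hs.le]
  field_simp
  ring

theorem integral_le_mul_log {f : ℝ → ℝ} {a b A : ℝ} (ha : 0 < a) (hab : a ≤ b) (hA : 0 ≤ A)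
    (hf : ∀ p ∈ Set.Icc a b, f p ≤ A * (1 / p)) :
    ∫ p in a..b, f p ≤ A * (Real.log b - Real.log a) := by
  rw [mul_sub]
  refine integral_le_of_le_deriv (G := fun p => A * Real.log p) hab (fun p hp => ?_)
    (fun p hp => ?_) hf
  · have hp0 : 0 < p := ha.trans_le hp.1
    exact ((Real.hasDerivAt_log hp0.ne').const_mul A).congr_deriv (by rw [one_div])
  · have hp0 : 0 < p := ha.trans_le hp.1
    positivity

section Bounds

variable {B α C : ℝ}

theorem one_le_log_of_three_le (hB : 3 ≤ B) : 1 ≤ Real.log B := by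
  rw [Real.le_log_iff_exp_le (by linarith)]
  linarith [Real.exp_one_lt_d9]

theorem ctil_nonneg (hB : 3 ≤ B) (hα : 0 < α) (k : ℕ) : 0 ≤ ctil B α k := by
  have := one_le_log_of_three_le hB
  cases k <;> simp only [ctil] <;> positivity

theorem chat_nonneg (hB : 3 ≤ B) (hα : 0 < α) : ∀ k, 0 ≤ chat B α k
  | 0 => le_rfl
  | 1 => by
    have := one_le_log_of_three_le hB
    have := Real.pi_pos
    simp only [chat]
    positivity
  | 2 => by
    have := one_le_log_of_three_le hB
    have := Real.pi_pos
    have := ctil_nonneg hB hα 1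
    have := chat_nonneg hB hα 1
    rw [chat]
    positivity
  | k + 3 => by
    have := one_le_log_of_three_le hB
    have := Real.pi_pos
    have := ctil_nonneg hB hα (k + 2)
    have := chat_nonneg hB hα (k + 2)
    rw [chat]
    positivity

theorem le_rpow_one_add (hB : 3 ≤ B) (hα : 0 < α) (hC : C = B ^ (1 + α)) : B ≤ C := by
  rw [hC]
  exact Real.self_le_rpow_of_one_le (by linarith) (by linarith)

theorem log_rpow_one_add (hB : 3 ≤ B) (hC : C = B ^ (1 + α)) :
    Real.log C = (1 + α) * Real.log B := by
  rw [hC, Real.log_rpow (by linarith)]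

theorem inv_log_mul_integral_le (hB : 3 ≤ B) (hα : 0 < α) (hC : C = B ^ (1 + α)) {F : ℝ → ℝ}
    {A x : ℝ} (hA : 0 ≤ A) (hx : 0 < x) (hF : ∀ y, 0 < y → F y ≤ A * y) :
    (Real.log B)⁻¹ * (∫ p in B..C, F (x / p)) ≤ A * α * x := by
  have hL := one_le_log_of_three_le hB
  have hB0 : 0 < B := by linarith
  have h := integral_le_mul_log (f := fun p => F (x / p)) hB0 (le_rpow_one_add hB hα hC)
    (mul_nonneg hA hx.le) fun p hp => by
      have := hF (x / p) (div_pos hx (hB0.trans_le hp.1))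
      exact this.trans_eq (by ring)
  rw [log_rpow_one_add hB hC] at h
  rw [inv_mul_le_iff₀ (by linarith)]
  linarith

theorem lamtil_le (hB : 3 ≤ B) (hα : 0 < α) (hC : C = B ^ (1 + α)) :
    ∀ k : ℕ, ∀ x : ℝ, 0 < x → lamtil B C k x ≤ ctil B α k * α ^ k * x
  | 0, x, hx => by
    simp only [lamtil, ctil]
    split_ifs <;> linarith
  | 1, x, hx => by
    have hL := one_le_log_of_three_le hB
    have hB0 : 0 < B := by linarith
    have h : ∫ p in B..C, lamtil B C 0 (x / p) ≤ x := by
      refine integral_le_of_le_deriv_of_cutoff (D := x) (G := id) (g := fun _ => 1)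
        (le_rpow_one_add hB hα hC) hx.le (fun p _ => hasDerivAt_id p) (fun _ _ => zero_le_one)
        (fun p _ _ => ?_) (fun p hp hxp => ?_) (fun _ => ?_)
      · simp only [lamtil]
        split_ifs <;> norm_num
      · have : x / p < 1 := (div_lt_one (hB0.trans_le hp.1)).2 hxp
        simp [lamtil, this.not_ge]
      · simp only [id]
        linarith [min_le_right C x]
    rw [lamtil, ctil, inv_mul_le_iff₀ (by linarith)]
    refine h.trans_eq ?_
    field_simp
  | k + 2, x, hx => by
    have h := inv_log_mul_integral_le hB hα hC (F := lamtil B C (k + 1))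
      (mul_nonneg (ctil_nonneg hB hα (k + 1)) (pow_nonneg hα.le (k + 1))) hx
      (lamtil_le hB hα hC (k + 1))
    rw [lamtil]
    refine h.trans_eq ?_
    simp only [ctil]
    ring

theorem Ehat_nonneg (hB : 3 ≤ B) : 0 ≤ Ehat B := by
  have := one_le_log_of_three_le hB
  have := Real.pi_pos
  unfold Ehat
  positivity

/-- The contribution of the error terms in one step of the recursion for `λ̂`. -/
theorem boundary_add_integral_deriv_Ehat_le (hB : 3 ≤ B) (hBC : B ≤ C) {F : ℝ → ℝ}
    {A x : ℝ} (hA : 0 ≤ A) (hx : 0 < x) (hF : ∀ y, 0 < y → F y ≤ A * y) :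
    2 * F (x / B) * Ehat B + ∫ p in B..C, F (x / p) * deriv Ehat p ≤
      A * x * ((4 + 3 * Real.log B) / (8 * Real.pi * √B)) := by
  have hL := one_le_log_of_three_le hB
  have hpi := Real.pi_pos
  have hB0 : 0 < B := by linarith
  have hlog : ∀ p, B ≤ p → 0 ≤ Real.log p := fun p hp => Real.log_nonneg (by linarith)
  have h := integral_le_of_le_deriv (f := fun p => F (x / p) * deriv Ehat p)
    (G := fun t => A * x * -((Real.log t + 4) / (8 * Real.pi * √t)))
    (g := fun p => A * x * (1 / p * ((Real.log p + 2) / (16 * Real.pi * √p)))) hBC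
    (fun p hp => (hasDerivAt_neg_log_add_four_div_sqrt (hB0.trans_le hp.1)).const_mul (A * x))
    (fun p hp => by
      have := hlog p hp.1
      have : 0 < p := hB0.trans_le hp.1
      positivity)
    (fun p hp => by
      have := hlog p hp.1
      have hp0 : 0 < p := hB0.trans_le hp.1
      rw [(hasDerivAt_Ehat hp0).deriv]
      refine (mul_le_mul_of_nonneg_right (hF (x / p) (by positivity)) (by positivity)).trans_eq ?_
      ring)
  have hCterm : 0 ≤ A * x * ((Real.log C + 4) / (8 * Real.pi * √C)) := by
    have := hlog C hBC
    positivity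
  have hE : 2 * F (x / B) * Ehat B ≤ A * x * (2 * Real.log B / (8 * Real.pi * √B)) := by
    have h₁ : 2 * F (x / B) * Ehat B ≤ 2 * (A * (x / B)) * Ehat B :=
      mul_le_mul_of_nonneg_right (by linarith [hF (x / B) (by positivity)]) (Ehat_nonneg hB)
    refine h₁.trans_eq ?_
    unfold Ehat
    obtain ⟨s, hs, hsB⟩ : ∃ s : ℝ, 0 < s ∧ B = s ^ 2 :=
      ⟨√B, Real.sqrt_pos.2 hB0, (Real.sq_sqrt hB0.le).symm⟩
    have hsq : √B = s := by rw [hsB, Real.sqrt_sq hs.le]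
    rw [hsq]
    generalize Real.log B = L
    rw [hsB]
    field_simp
  have hsum : A * x * ((4 + 3 * Real.log B) / (8 * Real.pi * √B)) =
      A * x * (2 * Real.log B / (8 * Real.pi * √B)) +
        A * x * ((Real.log B + 4) / (8 * Real.pi * √B)) := by ring
  rw [hsum]
  linarith

theorem lamhat_succ (B C : ℝ) (k : ℕ) (x : ℝ) :
    lamhat B C (k + 1) x = (Real.log B)⁻¹ * (∫ p in B..C, lamhat B C k (x / p))
      + 2 * (lamtil B C k (x / B) + lamhat B C k (x / B)) * Ehat B
      + ∫ p in B..C, (lamtil B C k (x / p) + lamhat B C k (x / p)) * deriv Ehat p := rfl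

theorem lamhat_one_nonpos (hB : 3 ≤ B) (hBC : B ≤ C) {x : ℝ} (hx : x < B) :
    lamhat B C 1 x ≤ 0 := by
  have hB0 : 0 < B := by linarith
  have hlt : ∀ p, B ≤ p → lamtil B C 0 (x / p) = 0 := fun p hp => by
    have : x / p < 1 := (div_lt_one (hB0.trans_le hp)).2 (hx.trans_le hp)
    simp [lamtil, this.not_ge]
  have hderiv : ∫ p in B..C, (lamtil B C 0 (x / p) + lamhat B C 0 (x / p)) * deriv Ehat p = 0 := by
    rw [intervalIntegral.integral_congr (g := fun _ => 0), intervalIntegral.integral_zero]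
    intro p hp
    rw [Set.uIcc_of_le hBC] at hp
    simp [hlt p hp.1, lamhat]
  rw [lamhat_succ, hderiv, hlt B le_rfl]
  simp [lamhat]

theorem lamhat_one_le_sqrt (hB : 3 ≤ B) (hα : 0 < α) (hC : C = B ^ (1 + α)) {x : ℝ} (hx : B ≤ x) :
    lamhat B C 1 x ≤ (2 + α) * Real.log B / (8 * Real.pi) * √x := by
  have hL := one_le_log_of_three_le hB
  have hpi := Real.pi_pos
  have hB0 : 0 < B := by linarith
  have hBC := le_rpow_one_add hB hα hC
  have hE' : ∀ p ∈ Set.Icc B C, 0 ≤ (Real.log p + 2) / (16 * Real.pi * √p) := fun p hp => by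
    have : 0 ≤ Real.log p := Real.log_nonneg (by linarith [hp.1])
    positivity
  have hEB : Ehat B ≤ Real.log B / (8 * Real.pi) * √x := by
    have := mul_le_mul_of_nonneg_left (Real.sqrt_le_sqrt hx)
      (show 0 ≤ Real.log B / (8 * Real.pi) by positivity)
    refine Eq.trans_le ?_ this
    unfold Ehat
    ring
  have hEm : Ehat (min C x) ≤ (1 + α) * Real.log B / (8 * Real.pi) * √x := by
    have hm : 0 < min C x := hB0.trans_le (le_min hBC hx)
    have hlog : Real.log (min C x) ≤ (1 + α) * Real.log B := by
      rw [← log_rpow_one_add hB hC]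
      exact Real.log_le_log hm (min_le_left _ _)
    have hsq : √(min C x) ≤ √x := Real.sqrt_le_sqrt (min_le_right _ _)
    have h : √(min C x) * Real.log (min C x) ≤ √x * ((1 + α) * Real.log B) :=
      mul_le_mul hsq hlog (Real.log_nonneg (by linarith [le_min hBC hx])) (Real.sqrt_nonneg _)
    have := mul_le_mul_of_nonneg_left h (show 0 ≤ 1 / (8 * Real.pi) by positivity)
    unfold Ehat
    calc _ = 1 / (8 * Real.pi) * (√(min C x) * Real.log (min C x)) := by ring
      _ ≤ _ := this
      _ = _ := by ring
  have hone : ∀ y, lamtil B C 0 y ≤ 1 := fun y => by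
    simp only [lamtil]
    split_ifs <;> norm_num
  have hderiv : ∫ p in B..C, (lamtil B C 0 (x / p) + lamhat B C 0 (x / p)) * deriv Ehat p ≤
      Real.log B * (1 + α) / (8 * Real.pi) * √x - Ehat B := by
    refine integral_le_of_le_deriv_of_cutoff (D := x) (G := Ehat) hBC ?_
      (fun p hp => hasDerivAt_Ehat (hB0.trans_le hp.1)) hE' (fun p hp _ => ?_)
      (fun p hp hxp => ?_) (fun _ => ?_)
    · have : 0 ≤ α * (Real.log B / (8 * Real.pi) * √x) := by positivity
      calc _ ≤ Real.log B / (8 * Real.pi) * √x - Ehat B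
            + α * (Real.log B / (8 * Real.pi) * √x) := by linarith
        _ = _ := by ring
    · rw [(hasDerivAt_Ehat (hB0.trans_le hp.1)).deriv]
      exact mul_le_of_le_one_left (hE' p hp) (by simpa [lamhat] using hone (x / p))
    · have : x / p < 1 := (div_lt_one (hB0.trans_le hp.1)).2 hxp
      simp [lamtil, lamhat, this.not_ge]
    · rw [mul_comm (Real.log B)]
      linarith
  have hbd : 2 * (lamtil B C 0 (x / B) + lamhat B C 0 (x / B)) * Ehat B ≤ 2 * Ehat B := by
    refine mul_le_mul_of_nonneg_right ?_ (Ehat_nonneg hB)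
    have := hone (x / B)
    simp only [lamhat]
    linarith
  have hzero : (Real.log B)⁻¹ * (∫ p in B..C, lamhat B C 0 (x / p)) = 0 := by simp [lamhat]
  rw [lamhat_succ, hzero]
  calc _ ≤ Real.log B / (8 * Real.pi) * √x + Real.log B * (1 + α) / (8 * Real.pi) * √x := by
        linarith
    _ = _ := by ring

theorem inv_log_mul_integral_lamhat_one_le (hB : 3 ≤ B) (hα : 0 < α) (hC : C = B ^ (1 + α))
    {x : ℝ} (hx : 0 < x) :
    (Real.log B)⁻¹ * (∫ p in B..C, lamhat B C 1 (x / p)) ≤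
      (6 + 3 * α) / (8 * Real.pi * √B) * x := by
  have hL := one_le_log_of_three_le hB
  have hpi := Real.pi_pos
  have hB0 : 0 < B := by linarith
  have hBC := le_rpow_one_add hB hα hC
  set K := (2 + α) * Real.log B / (8 * Real.pi) with hK
  have hK0 : 0 ≤ K := by positivity
  have hsx : √x * √(x / B) = x / √B := by
    rw [Real.sqrt_div hx.le, ← mul_div_assoc, Real.mul_self_sqrt hx.le]
  have h : ∫ p in B..C, lamhat B C 1 (x / p) ≤ 2 * K * (x / √B) := by
    refine integral_le_of_le_deriv_of_cutoff (D := x / B)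
      (G := fun p => 2 * K * √x * √p) (g := fun p => 2 * K * √x * (1 / (2 * √p)))
      hBC (by positivity)
      (fun p hp => (Real.hasDerivAt_sqrt (hB0.trans_le hp.1).ne').const_mul _)
      (fun p _ => by positivity) (fun p hp hpx => ?_) (fun p hp hpx => ?_) (fun _ => ?_)
    · have hp0 : 0 < p := hB0.trans_le hp.1
      have hBx : B ≤ x / p := by
        rw [le_div_iff₀ hB0] at hpx
        rw [le_div_iff₀ hp0]
        linarith
      refine (lamhat_one_le_sqrt hB hα hC hBx).trans_eq ?_
      rw [← hK, Real.sqrt_div hx.le]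
      field_simp
    · have hp0 : 0 < p := hB0.trans_le hp.1
      refine lamhat_one_nonpos hB hBC ?_
      rw [div_lt_iff₀ hB0] at hpx
      rw [div_lt_iff₀ hp0]
      linarith
    · have h₁ : 2 * K * √x * √(min C (x / B)) ≤ 2 * K * √x * √(x / B) :=
        mul_le_mul_of_nonneg_left (Real.sqrt_le_sqrt (min_le_right _ _)) (by positivity)
      have h₂ : 0 ≤ 2 * K * √x * √B := by positivity
      have h₃ : 2 * K * √x * √(x / B) = 2 * K * (x / √B) := by rw [← hsx]; ring
      linarith
  have hsB := Real.sqrt_pos.2 hB0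
  calc _ ≤ (Real.log B)⁻¹ * (2 * K * (x / √B)) :=
        mul_le_mul_of_nonneg_left h (by positivity)
    _ = (4 + 2 * α) / (8 * Real.pi * √B) * x := by
        rw [hK]
        field_simp
        ring
    _ ≤ _ := by
        gcongr <;> norm_num

theorem lamhat_le (hB : 3 ≤ B) (hα : 0 < α) (hC : C = B ^ (1 + α)) :
    ∀ k : ℕ, ∀ x : ℝ, 0 < x → lamhat B C k x ≤ chat B α k * α ^ k * x
  | 0, x, hx => by simp [lamhat, chat]
  | 1, x, hx => by
    have hL := one_le_log_of_three_le hB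
    have hpi := Real.pi_pos
    have hB0 : 0 < B := by linarith
    rcases lt_or_ge x B with hxB | hxB
    · refine (lamhat_one_nonpos hB (le_rpow_one_add hB hα hC) hxB).trans ?_
      have := chat_nonneg hB hα 1
      positivity
    · refine (lamhat_one_le_sqrt hB hα hC hxB).trans ?_
      have hs : √x ≤ x / √B := by
        rw [le_div_iff₀ (Real.sqrt_pos.2 hB0)]
        calc √x * √B ≤ √x * √x := by gcongr
          _ = x := Real.mul_self_sqrt hx.le
      refine (mul_le_mul_of_nonneg_left hs (by positivity)).trans_eq ?_
      rw [chat]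
      field_simp
  | k + 2, x, hx => by
    have hL := one_le_log_of_three_le hB
    have hpi := Real.pi_pos
    have hB0 : 0 < B := by linarith
    have hsB := Real.sqrt_pos.2 hB0
    have hprev := lamhat_le hB hα hC (k + 1)
    have hc := chat_nonneg hB hα (k + 1)
    have ht := ctil_nonneg hB hα (k + 1)
    have herr := boundary_add_integral_deriv_Ehat_le hB (le_rpow_one_add hB hα hC)
      (F := fun y => lamtil B C (k + 1) y + lamhat B C (k + 1) y)
      (A := (ctil B α (k + 1) + chat B α (k + 1)) * α ^ (k + 1)) (by positivity) hx
      fun y hy => by linarith [lamtil_le hB hα hC (k + 1) y hy, hprev y hy]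
    rw [lamhat_succ, add_assoc]
    cases k with
    | zero =>
      refine (add_le_add (inv_log_mul_integral_lamhat_one_le hB hα hC hx) herr).trans_eq ?_
      rw [chat.eq_3]
      simp only [zero_add]
      field_simp
    | succ k =>
      have hmain := inv_log_mul_integral_le hB hα hC (F := lamhat B C (k + 1 + 1))
        (A := chat B α (k + 1 + 1) * α ^ (k + 1 + 1)) (by positivity) hx hprev
      refine (add_le_add hmain herr).trans_eq ?_
      rw [chat.eq_4]
      field_simp
      ring

theorem chat_one_le (hB : 3 ≤ B) (hα : 0 < α) :
    chat B α 1 ≤ (1 + α) * Real.log B / (α * √B) := by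
  have hL := one_le_log_of_three_le hB
  have hpi := Real.pi_gt_three
  have hsB : 0 < √B := Real.sqrt_pos.2 (by linarith)
  rw [chat, div_le_div_iff₀ (by positivity) (by positivity)]
  have h : 2 + α ≤ 8 * Real.pi * (1 + α) := by nlinarith
  calc _ = (2 + α) * (Real.log B * α * √B) := by ring
    _ ≤ 8 * Real.pi * (1 + α) * (Real.log B * α * √B) := by gcongr
    _ = _ := by ring

theorem four_add_three_log_le (hB : 3 ≤ B) :
    (4 + 3 * Real.log B) / (8 * Real.pi) ≤ Real.log B / 3 := by
  have hL := one_le_log_of_three_le hB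
  have hpi := Real.pi_gt_three
  rw [div_le_div_iff₀ (by positivity) (by norm_num)]
  nlinarith

theorem chat_two_le (hB : 3 ≤ B) (hα : 0 < α) (hlog : Real.log B ^ 2 ≤ √B) :
    chat B α 2 ≤ 3 * (1 + α) / (α ^ 2 * √B) := by
  have hL := one_le_log_of_three_le hB
  have hpi := Real.pi_gt_three
  have hsB : 0 < √B := Real.sqrt_pos.2 (by linarith)
  have hw := four_add_three_log_le hB
  have h₁ : chat B α 1 ≤ (1 + α) / (α * Real.log B) := by
    refine (chat_one_le hB hα).trans ?_
    rw [div_le_div_iff₀ (by positivity) (by positivity)]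
    calc _ = (1 + α) * α * Real.log B ^ 2 := by ring
      _ ≤ (1 + α) * α * √B := by gcongr
      _ = _ := by ring
  have h₂ : (6 + 3 * α) / (8 * Real.pi) ≤ 1 + α := by
    rw [div_le_iff₀ (by positivity)]
    nlinarith
  have hc := ctil_nonneg hB hα 1
  have hc' := chat_nonneg hB hα 1
  rw [chat.eq_3]
  calc _ = ((6 + 3 * α) / (8 * Real.pi) + α * ((4 + 3 * Real.log B) / (8 * Real.pi)
          * (ctil B α 1 + chat B α 1))) / (α ^ 2 * √B) := by field_simp
    _ ≤ ((1 + α) + α * (Real.log B / 3 * (1 / (α * Real.log B) + (1 + α) / (α * Real.log B))))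
          / (α ^ 2 * √B) := by
        gcongr
        rw [ctil]
    _ = ((1 + α) + (2 + α) / 3) / (α ^ 2 * √B) := by
        congr 1
        field_simp
        ring
    _ ≤ _ := by
        gcongr
        linarith

theorem chat_le (hB : 3 ≤ B) (hα : 0 < α) (hαB : Real.log B / √B ≤ α)
    (hlog : Real.log B ^ 2 ≤ √B) :
    ∀ k : ℕ, 2 ≤ k → chat B α k ≤ ((2 : ℝ) ^ k - 1) * (1 + α) / (α ^ 2 * √B) := by
  have hL := one_le_log_of_three_le hB
  have hpi := Real.pi_pos
  have hsB : 0 < √B := Real.sqrt_pos.2 (by linarith)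
  have hw := four_add_three_log_le hB
  rw [div_le_iff₀ hsB] at hαB
  intro k hk
  induction k, hk using Nat.le_induction with
  | base =>
    refine (chat_two_le hB hα hlog).trans_eq ?_
    norm_num
  | succ k hk ih =>
    obtain ⟨j, rfl⟩ := Nat.exists_eq_add_of_le' hk
    have hc := chat_nonneg hB hα (j + 2)
    have hcoef : (4 + 3 * Real.log B) / (8 * Real.pi * α * √B) ≤ 1 := by
      calc _ = (4 + 3 * Real.log B) / (8 * Real.pi) / (α * √B) := by rw [div_div, mul_assoc _ α]
        _ ≤ 1 := by
          rw [div_le_one (by positivity)]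
          linarith
    have hctil : (4 + 3 * Real.log B) / (8 * Real.pi * α * √B) * ctil B α (j + 2) ≤
        (1 + α) / (α ^ 2 * √B) := by
      rw [ctil]
      calc _ = (4 + 3 * Real.log B) / (8 * Real.pi) / Real.log B / (α ^ 2 * √B) := by field_simp
        _ ≤ Real.log B / 3 / Real.log B / (α ^ 2 * √B) := by gcongr
        _ = (1 / 3) / (α ^ 2 * √B) := by field_simp
        _ ≤ _ := by
          gcongr
          linarith
    have hchat := mul_le_of_le_one_left hc hcoef
    rw [chat.eq_4, mul_add]
    calc _ ≤ 2 * (((2 : ℝ) ^ (j + 2) - 1) * (1 + α) / (α ^ 2 * √B)) + (1 + α) / (α ^ 2 * √B) := by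
          linarith
      _ = _ := by ring

end Bounds

theorem lamhat_bounds (B α C : ℝ) (hB : 3 ≤ B) (hα : 0 < α) (hC : C = B ^ (1 + α)) :
    (∀ k : ℕ, ∀ x : ℝ, 0 < x → lamhat B C k x ≤ chat B α k * α ^ k * x) ∧
    (Real.log B / Real.sqrt B ≤ α → (Real.log B) ^ 2 ≤ Real.sqrt B →
      chat B α 1 ≤ (1 + α) * Real.log B / (α * Real.sqrt B) ∧
      ∀ k : ℕ, 2 ≤ k → chat B α k ≤ ((2 : ℝ) ^ k - 1) * (1 + α) / (α ^ 2 * Real.sqrt B)) := by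
  exact ⟨lamhat_le hB hα hC, fun hαB hlog => ⟨chat_one_le hB hα, chat_le hB hα hαB hlog⟩⟩
end
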